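/- Fix K ∈ ℕ, extend γ to sl(m+1,ℝ) by γ(M) := γ(ξ) (ξ the g₁-component of M), and set 𝓛_M := L_{X^M} + γ(M) on C^∞(ℝ^m, ⊕_{k=0}^K S^k ℝ^m ⊗ Hom(V₁,V₂)). Then the Casimir operators of the representations 𝓛 and L are related by 𝒞 = C + N with N = 2 Σᵢ γ(εⁱ)∘L_{X^{eᵢ}}: for every f ∈ C^∞(ℝ^m, ⊕_{k=0}^K S^k ℝ^m ⊗ Hom(V₁,V₂)), Σᵢ[𝓛_{eᵢ}(𝓛_{εⁱ}f) + 𝓛_{εⁱ}(𝓛_{eᵢ}f)] + (1/(2m))·𝓛_E(𝓛_E f) + Σ_s 𝓛_{h_s}(𝓛_{h_s^*}f) = Σᵢ[L_{X^{eᵢ}}(L_{X^{εⁱ}}f) + L_{X^{εⁱ}}(L_{X^{eᵢ}}f)] + (1/(2m))·L_{X^E}(L_{X^E}f) + Σ_s L_{X^{h_s}}(L_{X^{h_s^*}}f) + 2 Σᵢ γ(εⁱ)(L_{X^{eᵢ}}f). -/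

import Mathlib

open scoped BigOperators
noncomputable section
namespace ProjQuant

/-- `ℝ^m`. -/
abbrev Rm (m : ℕ) := Fin m → ℝ

/-- The index set for `(m+1) × (m+1)` matrices, split into blocks. -/
abbrev Idx (m : ℕ) := Sum (Fin m) Unit

/-- `gl(m,ℝ)`, realized as continuous linear endomorphisms of `ℝ^m`. -/
abbrev GLm (m : ℕ) := (Fin m → ℝ) →L[ℝ] (Fin m → ℝ)

/-- `ℝ^{m*}`. -/
abbrev Dualm (m : ℕ) := (Fin m → ℝ) →L[ℝ] ℝ

/-- The vector field `X^M` on `ℝ^m` attached to a matrix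
`M = [[A, v], [ξ, a]] ∈ sl(m+1,ℝ)`, namely `X^M(x) = -v - A x + a x + ξ(x) x`. -/
def projVF (m : ℕ) (M : Matrix (Idx m) (Idx m) ℝ) : Rm m → Rm m := fun x i =>
  -(M (Sum.inl i) (Sum.inr ())) - (∑ j, M (Sum.inl i) (Sum.inl j) * x j)
    + M (Sum.inr ()) (Sum.inr ()) * x i
    + (∑ j, M (Sum.inr ()) (Sum.inl j) * x j) * x i

/-- The Lie derivative of a `V`-valued function along a vector field `X`, with respect to a
representation `σ` of `gl(m,ℝ)` on `V`:  `(L_X f)(x) = Df(x)[X(x)] - σ(DX(x))(f(x))`. -/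
def lieD (m : ℕ) {V : Type} [NormedAddCommGroup V] [NormedSpace ℝ V]
    (σ : GLm m → V → V) (X : Rm m → Rm m) (f : Rm m → V) : Rm m → V :=
  fun x => fderiv ℝ f x (X x) - σ (fderiv ℝ X x) (f x)

/-- `σ` is a Lie algebra representation of `gl(m,ℝ)`. -/
def IsLieRep (m : ℕ) {V : Type} [NormedAddCommGroup V] [NormedSpace ℝ V]
    (σ : GLm m →ₗ[ℝ] (V →L[ℝ] V)) : Prop :=
  ∀ A B : GLm m, σ (A ∘L B - B ∘L A) = σ A ∘L σ B - σ B ∘L σ A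


/-- Iterated Lie derivative along the constant fields `X^{hᵢ} = -hᵢ`, outermost first. -/
def lieItC (m : ℕ) {V : Type} [NormedAddCommGroup V] [NormedSpace ℝ V]
    (σ : GLm m → V → V) : (k : ℕ) → (Fin k → Rm m) → (Rm m → V) → (Rm m → V)
  | 0, _, f => f
  | (k+1), v, f => lieD m σ (fun _ => -(v 0)) (lieItC m σ k (fun j => v j.succ) f)

section Symbols

variable (m : ℕ) (V₁ V₂ : Type)
  [NormedAddCommGroup V₁] [NormedSpace ℝ V₁] [NormedAddCommGroup V₂] [NormedSpace ℝ V₂]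

/-- The model for `S^k ℝ^m ⊗ Hom(V₁,V₂)`: multilinear maps on `k` copies of `ℝ^{m*}`
with values in `Hom(V₁,V₂)` (symbols of degree `k` are the symmetric ones). -/
abbrev Symb (k : ℕ) := ContinuousMultilinearMap ℝ (fun _ : Fin k => Dualm m) (V₁ →L[ℝ] V₂)

/-- The decomposable tensor `h₁ ⊗ ⋯ ⊗ h_k ⊗ A` in the model. -/
def pureT {k : ℕ} (v : Fin k → Rm m) (A : V₁ →L[ℝ] V₂) : Symb m V₁ V₂ k :=
  (ContinuousMultilinearMap.mkPiRing ℝ (Fin k) A).compContinuousLinearMap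
    (fun i => ContinuousLinearMap.apply ℝ ℝ (v i))

/-- The symmetric product `h₁ ∨ ⋯ ∨ h_k ⊗ A` in the model. -/
def symT {k : ℕ} (v : Fin k → Rm m) (A : V₁ →L[ℝ] V₂) : Symb m V₁ V₂ k :=
  ∑ ν : Equiv.Perm (Fin k), pureT m V₁ V₂ (v ∘ ν) A

/-- The subspace of the model corresponding to `S^k ℝ^m ⊗ Hom(V₁,V₂)` itself:
the span of the symmetric products. -/
def spanGen (k : ℕ) : Submodule ℝ (Symb m V₁ V₂ k) :=
  Submodule.span ℝ {T | ∃ (v : Fin k → Rm m) (A : V₁ →L[ℝ] V₂), T = symT m V₁ V₂ v A}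

/-- The rank-one endomorphism `u ⊗ h : x ↦ h(x) • u` of `ℝ^m`. -/
def rkOne (u : Rm m) (h : Dualm m) : GLm m := h.smulRight u

variable (σ₁ : GLm m →ₗ[ℝ] (V₁ →L[ℝ] V₁)) (σ₂ : GLm m →ₗ[ℝ] (V₂ →L[ℝ] V₂))

/-- The representation `σ^{(k)}` of `gl(m,ℝ)` on `S^k ℝ^m ⊗ Hom(V₁,V₂)`, determined by
`σ^{(k)}(B)(h₁∨⋯∨h_k ⊗ A) = Σᵢ h₁∨⋯∨(B hᵢ)∨⋯∨h_k ⊗ A + h₁∨⋯∨h_k ⊗ (σ₂(B)∘A - A∘σ₁(B))`. -/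
def sigmaS {k : ℕ} (B : GLm m) (T : Symb m V₁ V₂ k) : Symb m V₁ V₂ k :=
  (∑ t : Fin k, T.compContinuousLinearMap
    (fun s => if s = t then (ContinuousLinearMap.compL ℝ (Rm m) (Rm m) ℝ).flip B
      else ContinuousLinearMap.id ℝ (Dualm m)))
  + ((ContinuousLinearMap.compL ℝ V₁ V₂ V₂ (σ₂ B))
      - (ContinuousLinearMap.compL ℝ V₁ V₁ V₂).flip (σ₁ B)).compContinuousMultilinearMap T

/-- The `i`-th coordinate covector on `ℝ^m`. -/
def coordD (i : Fin m) : Dualm m := ContinuousLinearMap.proj i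

/-- The affine quantization (standard ordering): the full contraction of a degree-`k` symbol
with the `k`-th derivative, `Q_Aff(h₁∨⋯∨h_k ⊗ A)(f) = A(∂_{h₁} ⋯ ∂_{h_k} f)`. -/
def QAff {k : ℕ} (T : Rm m → Symb m V₁ V₂ k) (f : Rm m → V₁) : Rm m → V₂ :=
  fun x => (k.factorial : ℝ)⁻¹ • ∑ d : Fin k → Fin m,
    (T x (fun t => coordD m (d t))) (iteratedFDeriv ℝ k f x (fun t => Pi.single (d t) 1))

/-- The defining property of the map `γ(h) : S^{k+1} ℝ^m ⊗ Hom(V₁,V₂) → S^k ℝ^m ⊗ Hom(V₁,V₂)`,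
for `h ∈ ℝ^{m*} ≅ 𝔤₁`:
`γ(h)(h₁∨⋯∨h_{k+1} ⊗ A) = Σᵢ h₁∨⋯(omit hᵢ)⋯∨h_{k+1} ⊗ (A ∘ σ₁(hᵢ⊗h + h(hᵢ)·Id))`
`- Σᵢ Σ_{j<i} h₁∨⋯(omit hⱼ,hᵢ)⋯∨h_{k+1} ∨ (h(hⱼ)·hᵢ + h(hᵢ)·hⱼ) ⊗ A`. -/
def gammaProp {k : ℕ}
    (γ : Dualm m → (Symb m V₁ V₂ (k+1) →ₗ[ℝ] Symb m V₁ V₂ k)) : Prop :=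
  ∀ (h : Dualm m) (v : Fin (k+1) → Rm m) (A : V₁ →L[ℝ] V₂),
    γ h (symT m V₁ V₂ v A) =
      (∑ i : Fin (k+1), symT m V₁ V₂ (i.removeNth v)
        (A.comp (σ₁ (rkOne m (v i) h + h (v i) • ContinuousLinearMap.id ℝ (Rm m)))))
      - ∑ i : Fin (k+1), ∑ j : Fin k,
          if (i.succAbove j : ℕ) < (i : ℕ) then
            symT m V₁ V₂ (i.removeNth (Function.update v (i.succAbove j)
              (h (v (i.succAbove j)) • v i + h (v i) • v (i.succAbove j)))) A
          else 0

/-- The model for `⊕_{k=0}^K S^k ℝ^m ⊗ Hom(V₁,V₂)`. -/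
abbrev SymbT (K : ℕ) := ∀ k : Fin (K+1), Symb m V₁ V₂ (k : ℕ)

/-- The degree-wise representation `⊕_k σ^{(k)}` on `⊕_{k=0}^K S^k ℝ^m ⊗ Hom(V₁,V₂)`. -/
def sigmaT {K : ℕ} (B : GLm m) (T : SymbT m V₁ V₂ K) : SymbT m V₁ V₂ K :=
  fun k => sigmaS m V₁ V₂ σ₁ σ₂ B (T k)

/-- The extension of a family `γ` to `⊕_{k=0}^K S^k ℝ^m ⊗ Hom(V₁,V₂)` (lowering degree). -/
def gTot {K : ℕ} (γf : ∀ k : ℕ, Dualm m → (Symb m V₁ V₂ (k+1) →ₗ[ℝ] Symb m V₁ V₂ k))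
    (h : Dualm m) (T : SymbT m V₁ V₂ K) : SymbT m V₁ V₂ K :=
  fun k => if hk : (k : ℕ) + 1 < K + 1 then γf (k : ℕ) h (T ⟨(k : ℕ) + 1, hk⟩) else 0


/-- The action `ρ^{(k)}(a) = S^k a ⊗ (Φ ↦ ρ₂(a)∘Φ∘ρ₁(a)⁻¹)` of `GL(m,ℝ)` on
`S^k ℝ^m ⊗ Hom(V₁,V₂)`, in the model. -/
def rhoK {k : ℕ} (a : (Fin m → ℝ) ≃L[ℝ] (Fin m → ℝ)) (r₁ : V₁ ≃L[ℝ] V₁) (r₂ : V₂ ≃L[ℝ] V₂)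
    (T : Symb m V₁ V₂ k) : Symb m V₁ V₂ k :=
  ((ContinuousLinearMap.compL ℝ V₁ V₂ V₂ (r₂ : V₂ →L[ℝ] V₂)) ∘L
    ((ContinuousLinearMap.compL ℝ V₁ V₁ V₂).flip
      ((r₁.symm : V₁ →L[ℝ] V₁)))).compContinuousMultilinearMap
    (T.compContinuousLinearMap
      (fun _ => (ContinuousLinearMap.compL ℝ (Rm m) (Rm m) ℝ).flip
        (a : (Fin m → ℝ) →L[ℝ] (Fin m → ℝ))))

end Symbols

section Matrices

variable (m : ℕ)

/-- The element of `𝔤₁ ⊂ sl(m+1,ℝ)` with `ξ`-block the covector `h`. -/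
def hMat (h : Dualm m) : Matrix (Idx m) (Idx m) ℝ :=
  Matrix.fromBlocks 0 0 (Matrix.of fun _ j => h (Pi.single j 1)) 0

/-- The element of `𝔤₋₁ ⊂ sl(m+1,ℝ)` with `v`-block the vector `X`. -/
def XMat (X : Rm m) : Matrix (Idx m) (Idx m) ℝ :=
  Matrix.fromBlocks 0 (Matrix.of fun i _ => X i) 0 0

/-- The lift `B̃ ∈ 𝔤₀ ⊂ sl(m+1,ℝ)` of `B ∈ gl(m,ℝ)`, with `ψ(B̃) = B`. -/
def BTilde (B : GLm m) : Matrix (Idx m) (Idx m) ℝ :=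
  Matrix.fromBlocks
    (LinearMap.toMatrix' (B : (Fin m → ℝ) →ₗ[ℝ] (Fin m → ℝ))
      - ((LinearMap.trace ℝ (Rm m) (B : (Fin m → ℝ) →ₗ[ℝ] (Fin m → ℝ))) / ((m : ℝ) + 1)) • 1)
    0 0
    (Matrix.of fun _ _ => -(LinearMap.trace ℝ (Rm m) (B : (Fin m → ℝ) →ₗ[ℝ] (Fin m → ℝ))) / ((m : ℝ) + 1))

/-- The map `ψ : 𝔤₀ → gl(m,ℝ) : [[A,0],[0,a]] ↦ A - a·Id`. -/
def psiC (M : Matrix (Idx m) (Idx m) ℝ) : GLm m :=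
  LinearMap.toContinuousLinearMap
    ((Matrix.of fun i j => M (Sum.inl i) (Sum.inl j)).mulVecLin
      - M (Sum.inr ()) (Sum.inr ()) • LinearMap.id)

/-- The basis `(eᵢ)` of `𝔤₋₁`, corresponding to the standard basis of `ℝ^m`. -/
def eMat (i : Fin m) : Matrix (Idx m) (Idx m) ℝ := XMat m (Pi.single i 1)

/-- The covector `εⁱ = (1/(2(m+1))) δⁱ ∈ ℝ^{m*}`. -/
def epsD (i : Fin m) : Dualm m := (1 / (2 * ((m : ℝ) + 1))) • coordD m i

/-- The basis `(εⁱ)` of `𝔤₁`, Killing-dual to `(eᵢ)`. -/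
def epsMat (i : Fin m) : Matrix (Idx m) (Idx m) ℝ := hMat m (epsD m i)

/-- The Euler element `E = diag(-1/(m+1), …, -1/(m+1), m/(m+1)) ∈ 𝔤₀`, with `ψ(E) = -Id`. -/
def EMat : Matrix (Idx m) (Idx m) ℝ :=
  Matrix.fromBlocks ((-(1 / ((m : ℝ) + 1))) • 1) 0 0 (Matrix.of fun _ _ => (m : ℝ) / ((m : ℝ) + 1))

/-- Membership in `𝔰 ≅ sl(m,ℝ) ⊂ 𝔤₀`: block diagonal with vanishing corner and traceless. -/
def inS (M : Matrix (Idx m) (Idx m) ℝ) : Prop :=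
  (∀ i, M (Sum.inl i) (Sum.inr ()) = 0) ∧ (∀ j, M (Sum.inr ()) (Sum.inl j) = 0) ∧
    M (Sum.inr ()) (Sum.inr ()) = 0 ∧ Matrix.trace M = 0

/-- Membership in `𝔤₋₁`: only the `v`-block is nonzero. -/
def inGm1 (M : Matrix (Idx m) (Idx m) ℝ) : Prop :=
  (∀ i j, M (Sum.inl i) (Sum.inl j) = 0) ∧ (∀ j, M (Sum.inr ()) (Sum.inl j) = 0) ∧
    M (Sum.inr ()) (Sum.inr ()) = 0

/-- Membership in `𝔤₁`: only the `ξ`-block is nonzero. -/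
def inG1 (M : Matrix (Idx m) (Idx m) ℝ) : Prop :=
  (∀ i j, M (Sum.inl i) (Sum.inl j) = 0) ∧ (∀ i, M (Sum.inl i) (Sum.inr ()) = 0) ∧
    M (Sum.inr ()) (Sum.inr ()) = 0

/-- Membership in `𝔤₀`: block diagonal. -/
def inG0 (M : Matrix (Idx m) (Idx m) ℝ) : Prop :=
  (∀ i, M (Sum.inl i) (Sum.inr ()) = 0) ∧ (∀ j, M (Sum.inr ()) (Sum.inl j) = 0)

/-- The Killing form of `sl(m+1,ℝ)`: `κ(M,N) = 2(m+1) tr(MN)`. -/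
def kappa (M N : Matrix (Idx m) (Idx m) ℝ) : ℝ := 2 * ((m : ℝ) + 1) * Matrix.trace (M * N)

end Matrices

section SymbolOperators

variable (m : ℕ) (V₁ V₂ : Type)
  [NormedAddCommGroup V₁] [NormedSpace ℝ V₁] [NormedAddCommGroup V₂] [NormedSpace ℝ V₂]
  (σ₁ : GLm m →ₗ[ℝ] (V₁ →L[ℝ] V₁)) (σ₂ : GLm m →ₗ[ℝ] (V₂ →L[ℝ] V₂))

/-- The operator `C₀ = (1/2)σ^{(k)}(Id) + (1/2m)σ^{(k)}(Id)² + Σ_s σ^{(k)}(ψ(h_s))∘σ^{(k)}(ψ(h_s^*))`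
on `S^k ℝ^m ⊗ Hom(V₁,V₂)`. -/
def C0op {k : ℕ} {n : ℕ} (hs hs' : Fin n → Matrix (Idx m) (Idx m) ℝ)
    (T : Symb m V₁ V₂ k) : Symb m V₁ V₂ k :=
  (1/2 : ℝ) • sigmaS m V₁ V₂ σ₁ σ₂ (ContinuousLinearMap.id ℝ (Rm m)) T
  + (1/(2*(m : ℝ))) • sigmaS m V₁ V₂ σ₁ σ₂ (ContinuousLinearMap.id ℝ (Rm m))
      (sigmaS m V₁ V₂ σ₁ σ₂ (ContinuousLinearMap.id ℝ (Rm m)) T)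
  + ∑ s, sigmaS m V₁ V₂ σ₁ σ₂ (psiC m (hs s)) (sigmaS m V₁ V₂ σ₁ σ₂ (psiC m (hs' s)) T)

/-- `C₀` acting degreewise on `⊕_{k=0}^K S^k ℝ^m ⊗ Hom(V₁,V₂)`. -/
def C0tot {K : ℕ} {n : ℕ} (hs hs' : Fin n → Matrix (Idx m) (Idx m) ℝ)
    (T : SymbT m V₁ V₂ K) : SymbT m V₁ V₂ K :=
  fun k => C0op m V₁ V₂ σ₁ σ₂ hs hs' (T k)

/-- The operator `𝓛_M = L_{X^M} + γ(ξ_M)` (flat curly Lie derivative) on functions with values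
in `⊕_{k=0}^K S^k ℝ^m ⊗ Hom(V₁,V₂)`, where `ξ_M` is the `𝔤₁`-component of `M`. -/
def curlyL {K : ℕ} (γf : ∀ k : ℕ, Dualm m → (Symb m V₁ V₂ (k+1) →ₗ[ℝ] Symb m V₁ V₂ k))
    (M : Matrix (Idx m) (Idx m) ℝ) (f : Rm m → SymbT m V₁ V₂ K) : Rm m → SymbT m V₁ V₂ K :=
  fun x => lieD m (fun B T => sigmaT m V₁ V₂ σ₁ σ₂ B T) (projVF m M) f x
    + gTot m V₁ V₂ γf (∑ j, M (Sum.inr ()) (Sum.inl j) • coordD m j) (f x)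

end SymbolOperators

section Curved

variable (m : ℕ) (P : Type) [NormedAddCommGroup P] [NormedSpace ℝ P]

/-- The invariant derivative `L_{ω^{-1}(Z)} f` along the `ω`-constant vector field `η Z`. -/
def LD (η : Matrix (Idx m) (Idx m) ℝ → P → P) (Z : Matrix (Idx m) (Idx m) ℝ)
    {V : Type} [NormedAddCommGroup V] [NormedSpace ℝ V] (f : P → V) : P → V :=
  fun u => fderiv ℝ f u (η Z u)

/-- The bracket compatibility satisfied by a normal Cartan connection: for `M ∈ 𝔤₀ ⊕ 𝔤₁` and
`N ∈ 𝔤₋₁`, `L_{ω^{-1}(M)} ∘ L_{ω^{-1}(N)} - L_{ω^{-1}(N)} ∘ L_{ω^{-1}(M)} = L_{ω^{-1}([M,N])}` on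
smooth vector-space-valued functions. -/
def BracketCompat (η : Matrix (Idx m) (Idx m) ℝ → P → P) : Prop :=
  ∀ (V : Type) [NormedAddCommGroup V] [NormedSpace ℝ V],
    ∀ f : P → V, ContDiff ℝ (⊤ : ℕ∞) f →
      ∀ M N : Matrix (Idx m) (Idx m) ℝ, Matrix.trace M = 0 → Matrix.trace N = 0 →
        (∀ i, M (Sum.inl i) (Sum.inr ()) = 0) → inGm1 m N →
        (LD m P η M (LD m P η N f) - LD m P η N (LD m P η M f)) = LD m P η (M * N - N * M) f

/-- Infinitesimal `G₀`-equivariance of `f : P → V` with respect to `σ`: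
`L_{ω^{-1}(B̃)} f = -σ(B) f` for all `B ∈ gl(m,ℝ)`. -/
def equivG0 (η : Matrix (Idx m) (Idx m) ℝ → P → P)
    {V : Type} [NormedAddCommGroup V] [NormedSpace ℝ V]
    (σ : GLm m → V → V) (f : P → V) : Prop :=
  ∀ B : GLm m, LD m P η (BTilde m B) f = fun u => -(σ B (f u))

/-- Iterated invariant derivatives along `𝔤₋₁`-constant fields. -/
def iterL (η : Matrix (Idx m) (Idx m) ℝ → P → P)
    {V : Type} [NormedAddCommGroup V] [NormedSpace ℝ V] :
    (k : ℕ) → (Fin k → Rm m) → (P → V) → (P → V)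
  | 0, _, f => f
  | (k+1), v, f => LD m P η (XMat m (v 0)) (iterL η k (fun j => v j.succ) f)

/-- The symmetrized iterated invariant differential `(∇^ω)^k f`, evaluated on
`(X₁, …, X_k) ∈ (ℝ^m)^k`. -/
def nabK (η : Matrix (Idx m) (Idx m) ℝ → P → P)
    {V : Type} [NormedAddCommGroup V] [NormedSpace ℝ V]
    (k : ℕ) (f : P → V) (v : Fin k → Rm m) : P → V :=
  fun u => (k.factorial : ℝ)⁻¹ • ∑ ν : Equiv.Perm (Fin k), iterL m P η k (v ∘ ν) f u

variable (V₁ V₂ : Type)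
  [NormedAddCommGroup V₁] [NormedSpace ℝ V₁] [NormedAddCommGroup V₂] [NormedSpace ℝ V₂]

/-- The curved quantization map: `Q_ω(T)(f)(u) = ⟨T(u), (∇^ω)^k f(u)⟩` (full contraction). -/
def Qom (η : Matrix (Idx m) (Idx m) ℝ → P → P) {k : ℕ}
    (T : P → Symb m V₁ V₂ k) (f : P → V₁) : P → V₂ :=
  fun u => (k.factorial : ℝ)⁻¹ • ∑ d : Fin k → Fin m,
    (T u (fun t => coordD m (d t))) (nabK m P η k f (fun t => Pi.single (d t) 1) u)


/-- The curved operator `N^ω f = -2 Σᵢ γ(εⁱ)(L_{ω^{-1}(eᵢ)} f)`. -/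
def Nom {K : ℕ} (γf : ∀ k : ℕ, Dualm m → (Symb m V₁ V₂ (k+1) →ₗ[ℝ] Symb m V₁ V₂ k))
    (η : Matrix (Idx m) (Idx m) ℝ → P → P) (f : P → SymbT m V₁ V₂ K) : P → SymbT m V₁ V₂ K :=
  fun u => (-2 : ℝ) • ∑ i : Fin m, gTot m V₁ V₂ γf (epsD m i)
    (LD m P η (XMat m (Pi.single i 1)) f u)

end Curved


section LieDerivative

theorem fderiv_apply_mem_of_isClosed {E F : Type*} [NormedAddCommGroup E] [NormedSpace ℝ E]
    [NormedAddCommGroup F] [NormedSpace ℝ F] (S : Submodule ℝ F) (hS : IsClosed (S : Set F))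
    {g : E → F} (hg : ∀ x, g x ∈ S) (x v : E) : fderiv ℝ g x v ∈ S := by
  by_cases hd : DifferentiableAt ℝ g x
  · have hl := range_deriv_subset_closure_span_image (𝕜 := ℝ) (fun t : ℝ => g (x + t • v))
      dense_univ (Set.mem_range_self (0 : ℝ))
    have hder : deriv (fun t : ℝ => g (x + t • v)) 0 = fderiv ℝ g x v :=
      hd.lineDeriv_eq_fderiv
    rw [hder] at hl
    refine closure_minimal (Submodule.span_le.2 ?_) hS hl
    rintro _ ⟨t, -, rfl⟩
    exact hg _
  · simp [fderiv_zero_of_not_differentiableAt hd]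

theorem lieD_mem (m : ℕ) {F : Type} [NormedAddCommGroup F] [NormedSpace ℝ F]
    [FiniteDimensional ℝ F] {p : F → Prop} (hzero : p 0) (hadd : ∀ a b, p a → p b → p (a + b))
    (hsmul : ∀ (r : ℝ) a, p a → p (r • a)) {σ : GLm m → F → F} (hσ : ∀ B T, p T → p (σ B T))
    (X : Rm m → Rm m) {g : Rm m → F} (hg : ∀ x, p (g x)) (x : Rm m) : p (lieD m σ X g x) := by
  let S : Submodule ℝ F :=
    { carrier := {a | p a}
      add_mem' := hadd _ _
      zero_mem' := hzero
      smul_mem' := hsmul }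
  have hS : lieD m σ X g x ∈ S :=
    sub_mem (fderiv_apply_mem_of_isClosed S S.closed_of_finiteDimensional hg _ _) (hσ _ _ (hg x))
  exact hS

theorem differentiable_lieD (m : ℕ) {F : Type} [NormedAddCommGroup F] [NormedSpace ℝ F]
    [FiniteDimensional ℝ F] (σ : GLm m →ₗ[ℝ] F →ₗ[ℝ] F) {X : Rm m → Rm m}
    (hX : ContDiff ℝ (⊤ : ℕ∞) X) {f : Rm m → F} (hf : ContDiff ℝ (⊤ : ℕ∞) f) :
    Differentiable ℝ (lieD m (fun B T => σ B T) X f) := by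
  let Φ : GLm m →L[ℝ] F →L[ℝ] F :=
    LinearMap.toContinuousLinearMap (LinearMap.toContinuousLinearMap.toLinearMap ∘ₗ σ)
  have hfd : Differentiable ℝ f := hf.differentiable (by simp)
  have hXd : Differentiable ℝ X := hX.differentiable (by simp)
  have hf' : Differentiable ℝ (fderiv ℝ f) :=
    (hf.fderiv_right (m := 1) (WithTop.coe_le_coe.2 le_top)).differentiable (by simp)
  have hX' : Differentiable ℝ (fderiv ℝ X) :=
    (hX.fderiv_right (m := 1) (WithTop.coe_le_coe.2 le_top)).differentiable (by simp)
  have hσ : Differentiable ℝ fun x => Φ (fderiv ℝ X x) (f x) :=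
    (Φ.differentiable.comp hX').clm_apply hfd
  exact (hf'.clm_apply hXd).sub hσ

theorem lieD_const_add_comp (m : ℕ) {F : Type} [NormedAddCommGroup F] [NormedSpace ℝ F]
    [FiniteDimensional ℝ F] {σ : GLm m → F → F} (hσ : ∀ T, σ 0 T = 0) (v : Rm m)
    (γ : F →ₗ[ℝ] F) {g f : Rm m → F} (hg : Differentiable ℝ g) (hf : Differentiable ℝ f)
    (x : Rm m) :
    lieD m σ (fun _ => v) (fun x => g x + γ (f x)) x
      = lieD m σ (fun _ => v) g x + γ (lieD m σ (fun _ => v) f x) := by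
  have hd : HasFDerivAt (fun x => g x + γ (f x))
      (fderiv ℝ g x + LinearMap.toContinuousLinearMap γ ∘L fderiv ℝ f x) x :=
    (hg x).hasFDerivAt.add
      ((LinearMap.toContinuousLinearMap γ).hasFDerivAt.comp x (hf x).hasFDerivAt)
  simp [lieD, hσ, hd.fderiv]

end LieDerivative

section CasimirRelation

variable (m : ℕ) (V₁ V₂ : Type)
  [NormedAddCommGroup V₁] [NormedSpace ℝ V₁] [NormedAddCommGroup V₂] [NormedSpace ℝ V₂]
  (σ₁ : GLm m →ₗ[ℝ] (V₁ →L[ℝ] V₁)) (σ₂ : GLm m →ₗ[ℝ] (V₂ →L[ℝ] V₂))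

theorem sigmaS_apply {k : ℕ} (B : GLm m) (T : Symb m V₁ V₂ k) (c : Fin k → Dualm m) :
    sigmaS m V₁ V₂ σ₁ σ₂ B T c
      = (∑ t, T (Function.update c t (c t ∘L B))) + (σ₂ B ∘L T c - T c ∘L σ₁ B) := by
  have h : ∀ t : Fin k, (fun s => (if s = t then
      (ContinuousLinearMap.compL ℝ (Rm m) (Rm m) ℝ).flip B
      else ContinuousLinearMap.id ℝ (Dualm m)) (c s)) = Function.update c t (c t ∘L B) := by
    intro t
    funext s
    by_cases hst : s = t
    · subst hst
      simp
    · simp [hst]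
  simp [sigmaS, h]

/-- `σ^{(k)}` as a bilinear map. -/
def sigmaSBilin (k : ℕ) : GLm m →ₗ[ℝ] Symb m V₁ V₂ k →ₗ[ℝ] Symb m V₁ V₂ k :=
  LinearMap.mk₂ ℝ (fun B T => sigmaS m V₁ V₂ σ₁ σ₂ B T)
    (fun B B' T => by
      ext c : 1
      simp only [add_apply, sigmaS_apply, ContinuousLinearMap.comp_add,
        ContinuousMultilinearMap.map_update_add, Finset.sum_add_distrib, map_add,
        ContinuousLinearMap.add_comp]
      abel)
    (fun r B T => by
      ext c : 1
      simp only [smul_apply, sigmaS_apply, ContinuousLinearMap.comp_smul,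
        ContinuousMultilinearMap.map_update_smul, ← Finset.smul_sum, map_smul,
        ContinuousLinearMap.smul_comp, smul_add, smul_sub])
    (fun B T T' => by
      ext c : 1
      simp only [add_apply, sigmaS_apply, ContinuousLinearMap.comp_add,
        Finset.sum_add_distrib, ContinuousLinearMap.add_comp]
      abel)
    (fun r B T => by
      ext c : 1
      simp only [smul_apply, sigmaS_apply, ContinuousLinearMap.comp_smul,
        ← Finset.smul_sum, ContinuousLinearMap.smul_comp, smul_add, smul_sub])

/-- `⊕_k σ^{(k)}` as a bilinear map. -/
def sigmaTBilin (K : ℕ) : GLm m →ₗ[ℝ] SymbT m V₁ V₂ K →ₗ[ℝ] SymbT m V₁ V₂ K :=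
  LinearMap.mk₂ ℝ (fun B T => sigmaT m V₁ V₂ σ₁ σ₂ B T)
    (fun B B' T => funext fun k => (sigmaSBilin m V₁ V₂ σ₁ σ₂ k).map_add₂ B B' (T k))
    (fun r B T => funext fun k => (sigmaSBilin m V₁ V₂ σ₁ σ₂ k).map_smul₂ r B (T k))
    (fun B T T' => funext fun k => (sigmaSBilin m V₁ V₂ σ₁ σ₂ k B).map_add (T k) (T' k))
    (fun r B T => funext fun k => (sigmaSBilin m V₁ V₂ σ₁ σ₂ k B).map_smul r (T k))

theorem sigmaT_zero_left {K : ℕ} (T : SymbT m V₁ V₂ K) :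
    sigmaT m V₁ V₂ σ₁ σ₂ 0 T = 0 :=
  (sigmaTBilin m V₁ V₂ σ₁ σ₂ K).map_zero₂ T

theorem symT_apply {k : ℕ} (v : Fin k → Rm m) (A : V₁ →L[ℝ] V₂) (c : Fin k → Dualm m) :
    symT m V₁ V₂ v A c = ∑ ν : Equiv.Perm (Fin k), (∏ i, c i (v (ν i))) • A := by
  simp [symT, pureT]

theorem sigmaS_symT {k : ℕ} (B : GLm m) (v : Fin k → Rm m) (A : V₁ →L[ℝ] V₂) :
    sigmaS m V₁ V₂ σ₁ σ₂ B (symT m V₁ V₂ v A)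
      = (∑ t, symT m V₁ V₂ (Function.update v t (B (v t))) A)
        + symT m V₁ V₂ v (σ₂ B ∘L A - A ∘L σ₁ B) := by
  ext c : 1
  simp only [sigmaS_apply, add_apply,
    sum_apply, symT_apply]
  congr 1
  · rw [Finset.sum_comm]
    conv_rhs => rw [Finset.sum_comm]
    refine Finset.sum_congr rfl fun ν _ => ?_
    rw [← Equiv.sum_comp ν (fun t => (∏ i, c i (Function.update v t (B (v t)) (ν i))) • A)]
    refine Finset.sum_congr rfl fun t _ => ?_
    congr 1
    refine Finset.prod_congr rfl fun i _ => ?_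
    by_cases h : i = t
    · subst h
      simp
    · simp [h]
  · simp only [ContinuousLinearMap.comp_finsetSum, ContinuousLinearMap.finsetSum_comp,
      ContinuousLinearMap.comp_smul, ContinuousLinearMap.smul_comp, smul_sub,
      Finset.sum_sub_distrib]

theorem symT_mem_spanGen {k : ℕ} (v : Fin k → Rm m) (A : V₁ →L[ℝ] V₂) :
    symT m V₁ V₂ v A ∈ spanGen m V₁ V₂ k :=
  Submodule.subset_span ⟨v, A, rfl⟩

theorem sigmaS_mem_spanGen {k : ℕ} (B : GLm m) {T : Symb m V₁ V₂ k}
    (hT : T ∈ spanGen m V₁ V₂ k) : sigmaS m V₁ V₂ σ₁ σ₂ B T ∈ spanGen m V₁ V₂ k := by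
  have h : spanGen m V₁ V₂ k ≤ (spanGen m V₁ V₂ k).comap (sigmaSBilin m V₁ V₂ σ₁ σ₂ k B) := by
    refine Submodule.span_le.2 ?_
    rintro _ ⟨v, A, rfl⟩
    change sigmaS m V₁ V₂ σ₁ σ₂ B (symT m V₁ V₂ v A) ∈ spanGen m V₁ V₂ k
    rw [sigmaS_symT]
    exact add_mem (sum_mem fun t _ => symT_mem_spanGen m V₁ V₂ _ _) (symT_mem_spanGen m V₁ V₂ _ _)
  exact h hT

theorem sub_mem_spanGen {k : ℕ} {S T : Symb m V₁ V₂ k} (hS : S ∈ spanGen m V₁ V₂ k)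
    (hT : T ∈ spanGen m V₁ V₂ k) : S - T ∈ spanGen m V₁ V₂ k := by
  have h : S - T = S + (-1 : ℝ) • T := by
    ext c : 1
    simp [sub_eq_add_neg]
  rw [h]
  exact add_mem hS ((spanGen m V₁ V₂ k).smul_mem _ hT)

variable {σ₁} in
theorem gammaProp.map_mem_spanGen {k : ℕ}
    {γ : Dualm m → (Symb m V₁ V₂ (k + 1) →ₗ[ℝ] Symb m V₁ V₂ k)}
    (hγ : gammaProp m V₁ V₂ σ₁ γ) (h : Dualm m) {T : Symb m V₁ V₂ (k + 1)}
    (hT : T ∈ spanGen m V₁ V₂ (k + 1)) : γ h T ∈ spanGen m V₁ V₂ k := by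
  have hle : spanGen m V₁ V₂ (k + 1) ≤ (spanGen m V₁ V₂ k).comap (γ h) := by
    refine Submodule.span_le.2 ?_
    rintro _ ⟨v, A, rfl⟩
    change γ h (symT m V₁ V₂ v A) ∈ spanGen m V₁ V₂ k
    rw [hγ]
    refine sub_mem_spanGen m V₁ V₂ (sum_mem fun i _ => symT_mem_spanGen m V₁ V₂ _ _)
      (sum_mem fun i _ => sum_mem fun j _ => ?_)
    split_ifs
    · exact symT_mem_spanGen m V₁ V₂ _ _
    · exact zero_mem _
  exact hle hT

variable {σ₁} in
theorem gammaProp.zero_apply {k : ℕ}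
    {γ : Dualm m → (Symb m V₁ V₂ (k + 1) →ₗ[ℝ] Symb m V₁ V₂ k)}
    (hγ : gammaProp m V₁ V₂ σ₁ γ) {T : Symb m V₁ V₂ (k + 1)}
    (hT : T ∈ spanGen m V₁ V₂ (k + 1)) : γ 0 T = 0 := by
  have hle : spanGen m V₁ V₂ (k + 1) ≤ LinearMap.ker (γ 0) := by
    refine Submodule.span_le.2 ?_
    rintro _ ⟨v, A, rfl⟩
    change γ 0 (symT m V₁ V₂ v A) = 0
    have hA : ∀ w : Fin k → Rm m, symT m V₁ V₂ w (0 : V₁ →L[ℝ] V₂) = 0 := fun w => by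
      ext c : 1
      simp [symT_apply]
    have hv : ∀ i : Fin (k + 1), ∀ j : Fin k,
        symT m V₁ V₂ (i.removeNth (Function.update v (i.succAbove j) 0)) A = 0 := fun i j => by
      ext c : 1
      rw [symT_apply]
      refine Finset.sum_eq_zero fun ν _ => ?_
      rw [Finset.prod_eq_zero (Finset.mem_univ (ν.symm j)), zero_smul]
      simp [Fin.removeNth]
    have hr : ∀ u, rkOne m u 0 = 0 := fun u => by
      ext
      simp [rkOne]
    rw [hγ]
    simp only [hr, hA, hv, _root_.zero_apply, zero_smul, add_zero, map_zero,
      ContinuousLinearMap.comp_zero, Finset.sum_const_zero, ite_self]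
    exact sub_zero (0 : Symb m V₁ V₂ k)
  exact hle hT

/-- The total symbol space `⊕_{k=0}^K S^k ℝ^m ⊗ Hom(V₁,V₂)` inside its model. -/
def spanGenT (K : ℕ) : Submodule ℝ (SymbT m V₁ V₂ K) :=
  Submodule.pi Set.univ fun k => spanGen m V₁ V₂ (k : ℕ)

theorem mem_spanGenT {K : ℕ} {T : SymbT m V₁ V₂ K} :
    T ∈ spanGenT m V₁ V₂ K ↔ ∀ k : Fin (K + 1), T k ∈ spanGen m V₁ V₂ (k : ℕ) := by
  simp [spanGenT, Submodule.mem_pi]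

/-- `gTot` as a linear map. -/
def gTotLin (K : ℕ) (γf : ∀ k : ℕ, Dualm m → (Symb m V₁ V₂ (k + 1) →ₗ[ℝ] Symb m V₁ V₂ k))
    (h : Dualm m) : SymbT m V₁ V₂ K →ₗ[ℝ] SymbT m V₁ V₂ K where
  toFun := gTot m V₁ V₂ γf h
  map_add' T T' := by
    funext k
    by_cases hk : (k : ℕ) + 1 < K + 1 <;> simp [gTot, hk]
  map_smul' r T := by
    funext k
    by_cases hk : (k : ℕ) + 1 < K + 1
    · simp [gTot, hk]
    · simp only [gTot, hk, dite_false, Pi.smul_apply]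
      exact (smul_zero (A := Symb m V₁ V₂ k) r).symm

variable {γf : ∀ k : ℕ, Dualm m → (Symb m V₁ V₂ (k + 1) →ₗ[ℝ] Symb m V₁ V₂ k)}

variable {σ₁} in
theorem gTot_mem_spanGenT (hγ : ∀ k : ℕ, gammaProp m V₁ V₂ σ₁ (γf k)) {K : ℕ} (h : Dualm m)
    {T : SymbT m V₁ V₂ K} (hT : T ∈ spanGenT m V₁ V₂ K) :
    gTot m V₁ V₂ γf h T ∈ spanGenT m V₁ V₂ K := by
  rw [mem_spanGenT] at hT ⊢
  intro k
  by_cases hk : (k : ℕ) + 1 < K + 1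
  · simpa only [gTot, hk, dite_true] using (hγ k).map_mem_spanGen m V₁ V₂ h (hT ⟨k + 1, hk⟩)
  · simp only [gTot, hk, dite_false, zero_mem]

variable {σ₁} in
theorem gTot_zero_left (hγ : ∀ k : ℕ, gammaProp m V₁ V₂ σ₁ (γf k)) {K : ℕ}
    {T : SymbT m V₁ V₂ K} (hT : T ∈ spanGenT m V₁ V₂ K) :
    gTot m V₁ V₂ γf 0 T = 0 := by
  rw [mem_spanGenT] at hT
  funext k
  by_cases hk : (k : ℕ) + 1 < K + 1
  · simp only [gTot, hk, dite_true]
    exact (hγ k).zero_apply m V₁ V₂ (hT ⟨k + 1, hk⟩)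
  · simp [gTot, hk]

instance finiteDimensional_symb [FiniteDimensional ℝ V₁] [FiniteDimensional ℝ V₂] (k : ℕ) :
    FiniteDimensional ℝ (Symb m V₁ V₂ k) :=
  Module.Finite.of_injective
    (ContinuousMultilinearMap.toMultilinearMapLinear (R' := ℝ) (A := ℝ)
      (M₁ := fun _ : Fin k => Dualm m) (M₂ := V₁ →L[ℝ] V₂))
    ContinuousMultilinearMap.toMultilinearMap_injective

theorem contDiff_projVF (M : Matrix (Idx m) (Idx m) ℝ) : ContDiff ℝ (⊤ : ℕ∞) (projVF m M) := by
  unfold projVF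
  fun_prop

theorem projVF_eMat (i : Fin m) :
    projVF m (eMat m i) = fun _ => -Pi.single i 1 := by
  funext x j
  simp [projVF, eMat, XMat]

variable {σ₁} in
theorem curlyL_of_lower_eq_zero (hγ : ∀ k : ℕ, gammaProp m V₁ V₂ σ₁ (γf k)) {K : ℕ}
    {M : Matrix (Idx m) (Idx m) ℝ} (hM : ∀ j, M (Sum.inr ()) (Sum.inl j) = 0)
    {g : Rm m → SymbT m V₁ V₂ K} (hg : ∀ x, g x ∈ spanGenT m V₁ V₂ K) :
    curlyL m V₁ V₂ σ₁ σ₂ γf M g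
      = lieD m (fun B S => sigmaT m V₁ V₂ σ₁ σ₂ B S) (projVF m M) g := by
  funext x
  simp [curlyL, hM, gTot_zero_left m V₁ V₂ hγ (hg x)]

theorem curlyL_epsMat {K : ℕ} (i : Fin m) (g : Rm m → SymbT m V₁ V₂ K) :
    curlyL m V₁ V₂ σ₁ σ₂ γf (epsMat m i) g
      = fun x => lieD m (fun B S => sigmaT m V₁ V₂ σ₁ σ₂ B S) (projVF m (epsMat m i)) g x
        + gTot m V₁ V₂ γf (epsD m i) (g x) := by
  have h : (∑ j, epsMat m i (Sum.inr ()) (Sum.inl j) • coordD m j) = epsD m i := by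
    ext y
    simp [epsMat, hMat, epsD, coordD, Pi.single_apply]
  funext x
  rw [curlyL, h]

theorem lieD_mem_spanGenT [FiniteDimensional ℝ V₁] [FiniteDimensional ℝ V₂] {K : ℕ}
    (X : Rm m → Rm m) {g : Rm m → SymbT m V₁ V₂ K}
    (hg : ∀ x, g x ∈ spanGenT m V₁ V₂ K) (x : Rm m) :
    lieD m (fun B S => sigmaT m V₁ V₂ σ₁ σ₂ B S) X g x ∈ spanGenT m V₁ V₂ K := by
  refine lieD_mem m (p := fun T => T ∈ spanGenT m V₁ V₂ K) ?_ (fun a b ha hb => ?_)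
    (fun r a ha => ?_) (fun B T hT => ?_) X hg x
  · exact (spanGenT m V₁ V₂ K).zero_mem
  · exact (spanGenT m V₁ V₂ K).add_mem ha hb
  · exact (spanGenT m V₁ V₂ K).smul_mem r ha
  · exact (mem_spanGenT m V₁ V₂).2 fun k =>
      sigmaS_mem_spanGen m V₁ V₂ σ₁ σ₂ B ((mem_spanGenT m V₁ V₂).1 hT k)

end CasimirRelation

/-- the Casimir operators of `𝓛` and `L` are related by `𝒞 = C + N`, with
`N = 2 Σᵢ γ(εⁱ)∘L_{X^{eᵢ}}`. -/
theorem statement13 (m K : ℕ) (hm : 2 ≤ m)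
    (V₁ V₂ : Type) [NormedAddCommGroup V₁] [NormedSpace ℝ V₁] [FiniteDimensional ℝ V₁]
    [NormedAddCommGroup V₂] [NormedSpace ℝ V₂] [FiniteDimensional ℝ V₂]
    (σ₁ : GLm m →ₗ[ℝ] (V₁ →L[ℝ] V₁)) (hσ₁ : IsLieRep m σ₁)
    (σ₂ : GLm m →ₗ[ℝ] (V₂ →L[ℝ] V₂)) (hσ₂ : IsLieRep m σ₂)
    (γf : ∀ k : ℕ, Dualm m → (Symb m V₁ V₂ (k+1) →ₗ[ℝ] Symb m V₁ V₂ k))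
    (hγ : ∀ k : ℕ, gammaProp m V₁ V₂ σ₁ (γf k))
    (n : ℕ) (hs hs' : Fin n → Matrix (Idx m) (Idx m) ℝ)
    (hmem : ∀ s, inS m (hs s)) (hmem' : ∀ s, inS m (hs' s))
    (hdual : ∀ s t, kappa m (hs s) (hs' t) = if s = t then 1 else 0)
    (hcompl : ∀ Y, inS m Y → (∑ s, kappa m Y (hs' s) • hs s) = Y)
    (f : Rm m → SymbT m V₁ V₂ K) (hf : ContDiff ℝ (⊤ : ℕ∞) f)
    (hfval : ∀ x (k : Fin (K+1)), f x k ∈ spanGen m V₁ V₂ (k : ℕ)) (x : Rm m) :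
    (∑ i : Fin m,
        (curlyL m V₁ V₂ σ₁ σ₂ γf (eMat m i) (curlyL m V₁ V₂ σ₁ σ₂ γf (epsMat m i) f) x
        + curlyL m V₁ V₂ σ₁ σ₂ γf (epsMat m i) (curlyL m V₁ V₂ σ₁ σ₂ γf (eMat m i) f) x))
      + (1/(2*(m : ℝ))) • curlyL m V₁ V₂ σ₁ σ₂ γf (EMat m)
          (curlyL m V₁ V₂ σ₁ σ₂ γf (EMat m) f) x
      + ∑ s : Fin n, curlyL m V₁ V₂ σ₁ σ₂ γf (hs s) (curlyL m V₁ V₂ σ₁ σ₂ γf (hs' s) f) x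
    = (∑ i : Fin m,
        (lieD m (fun B S => sigmaT m V₁ V₂ σ₁ σ₂ B S) (projVF m (eMat m i))
          (lieD m (fun B S => sigmaT m V₁ V₂ σ₁ σ₂ B S) (projVF m (epsMat m i)) f) x
        + lieD m (fun B S => sigmaT m V₁ V₂ σ₁ σ₂ B S) (projVF m (epsMat m i))
          (lieD m (fun B S => sigmaT m V₁ V₂ σ₁ σ₂ B S) (projVF m (eMat m i)) f) x))
      + (1/(2*(m : ℝ))) • lieD m (fun B S => sigmaT m V₁ V₂ σ₁ σ₂ B S) (projVF m (EMat m))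
          (lieD m (fun B S => sigmaT m V₁ V₂ σ₁ σ₂ B S) (projVF m (EMat m)) f) x
      + ∑ s : Fin n, lieD m (fun B S => sigmaT m V₁ V₂ σ₁ σ₂ B S) (projVF m (hs s))
          (lieD m (fun B S => sigmaT m V₁ V₂ σ₁ σ₂ B S) (projVF m (hs' s)) f) x
      + (2 : ℝ) • ∑ i : Fin m, gTot m V₁ V₂ γf (epsD m i)
          (lieD m (fun B S => sigmaT m V₁ V₂ σ₁ σ₂ B S) (projVF m (eMat m i)) f x) := by
  have hmemT : ∀ x, f x ∈ spanGenT m V₁ V₂ K := fun x => (mem_spanGenT m V₁ V₂).2 (hfval x)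
  have he : ∀ i j, eMat m i (Sum.inr ()) (Sum.inl j) = 0 := fun i j => by simp [eMat, XMat]
  have hE : ∀ j, EMat m (Sum.inr ()) (Sum.inl j) = 0 := fun j => by simp [EMat]
  have hL : ∀ M x, lieD m (fun B S => sigmaT m V₁ V₂ σ₁ σ₂ B S) (projVF m M) f x
      ∈ spanGenT m V₁ V₂ K := fun M x => lieD_mem_spanGenT m V₁ V₂ σ₁ σ₂ _ hmemT x
  have hterm : ∀ i : Fin m,
      curlyL m V₁ V₂ σ₁ σ₂ γf (eMat m i) (curlyL m V₁ V₂ σ₁ σ₂ γf (epsMat m i) f) x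
        + curlyL m V₁ V₂ σ₁ σ₂ γf (epsMat m i) (curlyL m V₁ V₂ σ₁ σ₂ γf (eMat m i) f) x
      = lieD m (fun B S => sigmaT m V₁ V₂ σ₁ σ₂ B S) (projVF m (eMat m i))
          (lieD m (fun B S => sigmaT m V₁ V₂ σ₁ σ₂ B S) (projVF m (epsMat m i)) f) x
        + lieD m (fun B S => sigmaT m V₁ V₂ σ₁ σ₂ B S) (projVF m (epsMat m i))
          (lieD m (fun B S => sigmaT m V₁ V₂ σ₁ σ₂ B S) (projVF m (eMat m i)) f) x
        + (2 : ℝ) • gTot m V₁ V₂ γf (epsD m i)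
          (lieD m (fun B S => sigmaT m V₁ V₂ σ₁ σ₂ B S) (projVF m (eMat m i)) f x) := by
    intro i
    rw [curlyL_of_lower_eq_zero m V₁ V₂ σ₂ hγ (he i) hmemT, curlyL_epsMat, curlyL_epsMat,
      curlyL_of_lower_eq_zero m V₁ V₂ σ₂ hγ (he i) fun x =>
        add_mem (hL _ x) (gTot_mem_spanGenT m V₁ V₂ hγ _ (hmemT x)),
      projVF_eMat]
    have hadd := lieD_const_add_comp m (sigmaT_zero_left m V₁ V₂ σ₁ σ₂ (K := K))
      (-Pi.single i 1) (gTotLin m V₁ V₂ K γf (epsD m i))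
      (differentiable_lieD m (sigmaTBilin m V₁ V₂ σ₁ σ₂ K) (contDiff_projVF m (epsMat m i)) hf)
      (hf.differentiable (by simp)) x
    refine (congrArg (· + _) hadd).trans ?_
    rw [two_smul ℝ (gTot m V₁ V₂ γf (epsD m i) _)]
    exact add_add_add_comm _ _ _ _
  simp only [hterm, curlyL_of_lower_eq_zero m V₁ V₂ σ₂ hγ hE hmemT,
    curlyL_of_lower_eq_zero m V₁ V₂ σ₂ hγ hE (hL _),
    curlyL_of_lower_eq_zero m V₁ V₂ σ₂ hγ (hmem' _).2.1 hmemT,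
    curlyL_of_lower_eq_zero m V₁ V₂ σ₂ hγ (hmem _).2.1 (hL _),
    Finset.sum_add_distrib, Finset.smul_sum]
  abel

end ProjQuant
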